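/- Let f, g : ℂⁿ → ℂ be polynomials. If f and g are bi-Lipschitz right-left equivalent at infinity, then deg(f) = deg(g). -/

import Mathlib

open MvPolynomial

/-- Two polynomials `f, g : ℂⁿ → ℂ` are bi-Lipschitz right-left equivalent at infinity:
there are compact subsets `K, K' ⊆ ℂⁿ`, a bi-Lipschitz homeomorphism
`φ : ℂⁿ \ K → ℂⁿ \ K'` and a bi-Lipschitz homeomorphism `ψ : ℂ → ℂ` such that
`f x = ψ (g (φ x))` for all `x ∈ ℂⁿ \ K`. -/
def BiLipschitzRightLeftEquivAtInfinity {n : ℕ} (f g : MvPolynomial (Fin n) ℂ) : Prop :=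
  ∃ K K' : Set (EuclideanSpace ℂ (Fin n)), IsCompact K ∧ IsCompact K' ∧
    ∃ φ : EuclideanSpace ℂ (Fin n) → EuclideanSpace ℂ (Fin n),
      Set.BijOn φ Kᶜ K'ᶜ ∧
      (∃ L : ℝ, 0 < L ∧ ∀ x ∈ Kᶜ, ∀ y ∈ Kᶜ,
        (1 / L) * ‖x - y‖ ≤ ‖φ x - φ y‖ ∧ ‖φ x - φ y‖ ≤ L * ‖x - y‖) ∧
      ∃ ψ : ℂ → ℂ, Function.Bijective ψ ∧
        (∃ L' : ℝ, 0 < L' ∧ ∀ a b : ℂ,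
          (1 / L') * ‖a - b‖ ≤ ‖ψ a - ψ b‖ ∧ ‖ψ a - ψ b‖ ≤ L' * ‖a - b‖) ∧
        (∀ x ∈ Kᶜ, eval (fun i => x i) f = ψ (eval (fun i => (φ x) i) g))

open Filter Topology in
/-- A finite sum `∑ i ≤ m, tⁱ cᵢ` which is `O(tᵈ)` along the positive integers with `d < m` has
vanishing coefficient `cₘ`. -/
theorem coeff_eq_zero_of_norm_sum_pow_le {m d : ℕ} (hdm : d < m) (c : ℕ → ℂ) (D : ℝ)
    (hD : ∀ k : ℕ, 1 ≤ k →
      ‖∑ i ∈ Finset.range (m + 1), (k : ℂ) ^ i * c i‖ ≤ D * (k : ℝ) ^ d) :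
    c m = 0 := by
  have hpow : ∀ j : ℕ, j ≠ 0 → Tendsto (fun k : ℕ => ((k : ℂ)⁻¹) ^ j) atTop (𝓝 0) := by
    intro j hj
    simpa [hj] using (tendsto_inv_atTop_nhds_zero_nat (𝕜 := ℂ)).pow j
  have h1 : Tendsto (fun k : ℕ => ∑ i ∈ Finset.range m, ((k : ℂ)⁻¹) ^ (m - i) * c i + c m)
      atTop (𝓝 (c m)) := by
    have : Tendsto (fun k : ℕ => ∑ i ∈ Finset.range m, ((k : ℂ)⁻¹) ^ (m - i) * c i)
        atTop (𝓝 (∑ i ∈ Finset.range m, 0)) := by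
      refine tendsto_finsetSum _ fun i hi => ?_
      have hi' := Finset.mem_range.mp hi
      simpa using (hpow (m - i) (by omega)).mul_const (c i)
    simpa using this.add_const (c m)
  have h2 : Tendsto (fun k : ℕ => ∑ i ∈ Finset.range m, ((k : ℂ)⁻¹) ^ (m - i) * c i + c m)
      atTop (𝓝 0) := by
    have hlim : Tendsto (fun k : ℕ => D * ((k : ℝ)⁻¹) ^ (m - d)) atTop (𝓝 0) := by
      have := (tendsto_inv_atTop_nhds_zero_nat (𝕜 := ℝ)).pow (m - d)
      simpa [show m - d ≠ 0 by omega] using this.const_mul D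
    refine squeeze_zero_norm' ?_ hlim
    filter_upwards [eventually_ge_atTop 1] with k hk
    have hk0 : (k : ℂ) ≠ 0 := by exact_mod_cast (by omega : k ≠ 0)
    have hk0' : (k : ℝ) ≠ 0 := by exact_mod_cast (by omega : k ≠ 0)
    have heq : ∑ i ∈ Finset.range m, ((k : ℂ)⁻¹) ^ (m - i) * c i + c m
        = ((k : ℂ)⁻¹) ^ m * ∑ i ∈ Finset.range (m + 1), (k : ℂ) ^ i * c i := by
      rw [Finset.sum_range_succ, mul_add, Finset.mul_sum]
      congr 1
      · refine Finset.sum_congr rfl fun i hi => ?_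
        rw [inv_pow_sub₀ hk0 (Finset.mem_range.mp hi).le, inv_pow]
        ring
      · rw [← mul_assoc, ← mul_pow, inv_mul_cancel₀ hk0, one_pow, one_mul]
    rw [heq, norm_mul, norm_pow, norm_inv, Complex.norm_natCast]
    calc ((k : ℝ)⁻¹) ^ m * _ ≤ ((k : ℝ)⁻¹) ^ m * (D * (k : ℝ) ^ d) := by gcongr; exact hD k hk
      _ = D * ((k : ℝ)⁻¹) ^ (m - d) := by
        rw [inv_pow_sub₀ hk0' hdm.le, inv_pow]; ring
  exact tendsto_nhds_unique h1 h2

/-- A polynomial map of growth order at most `d` has total degree at most `d`. -/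
theorem totalDegree_le_of_norm_eval_le {n : ℕ} (g : MvPolynomial (Fin n) ℂ) (d : ℕ) (C : ℝ)
    (hg : ∀ y : EuclideanSpace ℂ (Fin n), ‖eval (fun i => y i) g‖ ≤ C * (1 + ‖y‖) ^ d) :
    g.totalDegree ≤ d := by
  by_contra! hd
  have hC : 0 ≤ C := by
    have := (norm_nonneg _).trans (hg 0)
    simpa using this
  have hg0 : g ≠ 0 := by
    rintro rfl
    simp at hd
  suffices hcomp : homogeneousComponent g.totalDegree g = 0 by
    obtain ⟨s, hs, hdeg⟩ := g.support.exists_mem_eq_sup (support_nonempty.mpr hg0)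
      fun s => s.sum fun _ e => e
    have hcoeff := coeff_homogeneousComponent g.totalDegree g s
    rw [hcomp, coeff_zero, if_pos (by rw [totalDegree, hdeg]; rfl)] at hcoeff
    exact mem_support_iff.mp hs hcoeff.symm
  refine MvPolynomial.funext fun v => ?_
  rw [map_zero]
  refine coeff_eq_zero_of_norm_sum_pow_le hd
    (fun i => eval v (homogeneousComponent i g)) (C * (1 + ‖WithLp.toLp 2 v‖) ^ d) fun k hk => ?_
  have hk1 : (1 : ℝ) ≤ k := by exact_mod_cast hk
  have heval : ∑ i ∈ Finset.range (g.totalDegree + 1),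
      (k : ℂ) ^ i * eval v (homogeneousComponent i g) = eval ((k : ℂ) • v) g := by
    conv_rhs => rw [← sum_homogeneousComponent g, map_sum]
    refine Finset.sum_congr rfl fun i _ => ?_
    rw [eval_eq, eval_eq, Finset.mul_sum]
    refine Finset.sum_congr rfl fun s hs => ?_
    have hdeg := (homogeneousComponent_isHomogeneous i g).degree_eq_sum_deg_support hs
    simp only [Pi.smul_apply, smul_eq_mul, mul_pow, Finset.prod_mul_distrib,
      Finset.prod_pow_eq_pow_sum, ← hdeg]
    ring
  rw [heval]
  have hkv := hg ((k : ℂ) • WithLp.toLp 2 v)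
  rw [norm_smul, Complex.norm_natCast] at hkv
  calc ‖eval ((k : ℂ) • v) g‖ ≤ C * (1 + k * ‖WithLp.toLp 2 v‖) ^ d := hkv
    _ ≤ C * ((1 + ‖WithLp.toLp 2 v‖) * k) ^ d := by
      gcongr
      nlinarith [norm_nonneg (WithLp.toLp 2 v)]
    _ = _ := by rw [mul_pow]; ring

/-- A polynomial map has growth order at most its total degree. -/
theorem exists_norm_eval_le {n : ℕ} (f : MvPolynomial (Fin n) ℂ) :
    ∃ C : ℝ, 0 ≤ C ∧ ∀ x : EuclideanSpace ℂ (Fin n),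
      ‖eval (fun i => x i) f‖ ≤ C * (1 + ‖x‖) ^ f.totalDegree := by
  refine ⟨∑ s ∈ f.support, ‖coeff s f‖, by positivity, fun x => ?_⟩
  rw [eval_eq, Finset.sum_mul]
  refine (norm_sum_le _ _).trans (Finset.sum_le_sum fun s hs => ?_)
  rw [norm_mul]
  gcongr
  have h1 : (1 : ℝ) ≤ 1 + ‖x‖ := by linarith [norm_nonneg x]
  calc ‖∏ i ∈ s.support, x i ^ s i‖ = ∏ i ∈ s.support, ‖x i‖ ^ s i := by simp [norm_prod]
    _ ≤ ∏ i ∈ s.support, (1 + ‖x‖) ^ s i := by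
      refine Finset.prod_le_prod (fun i _ => by positivity) fun i _ => ?_
      gcongr
      linarith [PiLp.norm_apply_le x i]
    _ = (1 + ‖x‖) ^ s.degree := by rw [Finset.prod_pow_eq_pow_sum, Finsupp.degree_apply]
    _ ≤ _ := pow_le_pow_right₀ h1 (le_totalDegree hs)

/-- If, outside a compact set, the values of `g` are controlled affinely by values of `f` at points
whose norm is controlled affinely, then the total degree of `g` is at most that of `f`. -/
theorem totalDegree_le_of_affine_control {n : ℕ} (f g : MvPolynomial (Fin n) ℂ)
    {K : Set (EuclideanSpace ℂ (Fin n))} (hK : IsCompact K) (A M : ℝ) (hM : 0 ≤ M)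
    (h : ∀ y ∈ Kᶜ, ∃ x : EuclideanSpace ℂ (Fin n), ‖x‖ ≤ A + M * ‖y‖ ∧
      ‖eval (fun i => y i) g‖ ≤ A + M * ‖eval (fun i => x i) f‖) :
    g.totalDegree ≤ f.totalDegree := by
  obtain ⟨C, hC, hf⟩ := exists_norm_eval_le f
  have hcont : Continuous fun y : EuclideanSpace ℂ (Fin n) => eval (fun i => y i) g :=
    (MvPolynomial.continuous_eval g).comp (by fun_prop)
  obtain ⟨B, hB⟩ := hK.exists_bound_of_continuousOn hcont.continuousOn
  set d := f.totalDegree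
  refine totalDegree_le_of_norm_eval_le g d (|B| + |A| + M * C * (1 + |A| + M) ^ d) fun y => ?_
  have hy1 : (1 : ℝ) ≤ (1 + ‖y‖) ^ d := one_le_pow₀ (by linarith [norm_nonneg y])
  have hrest : 0 ≤ M * C * (1 + |A| + M) ^ d := by positivity
  by_cases hy : y ∈ K
  · calc _ ≤ B := hB y hy
      _ ≤ (|B| + |A| + M * C * (1 + |A| + M) ^ d) * 1 := by
        linarith [le_abs_self B, abs_nonneg A]
      _ ≤ _ := by gcongr
  · obtain ⟨x, hx, hgx⟩ := h y hy
    have hx' : 1 + ‖x‖ ≤ (1 + |A| + M) * (1 + ‖y‖) := by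
      nlinarith [le_abs_self A, abs_nonneg A, norm_nonneg y, mul_nonneg (abs_nonneg A)
        (norm_nonneg y)]
    calc _ ≤ A + M * ‖eval (fun i => x i) f‖ := hgx
      _ ≤ A + M * (C * ((1 + |A| + M) * (1 + ‖y‖)) ^ d) := by
        gcongr
        exact (hf x).trans (by gcongr)
      _ = A + M * C * (1 + |A| + M) ^ d * (1 + ‖y‖) ^ d := by rw [mul_pow]; ring
      _ ≤ (|B| + |A|) * (1 + ‖y‖) ^ d + M * C * (1 + |A| + M) ^ d * (1 + ‖y‖) ^ d := by
        gcongr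
        nlinarith [le_abs_self A, abs_nonneg A, abs_nonneg B]
      _ = _ := by ring

/-- If two polynomials are bi-Lipschitz right-left equivalent at infinity, then they
have the same total degree. -/
theorem totalDegree_eq_of_biLipschitzRightLeftEquivAtInfinity {n : ℕ}
    (f g : MvPolynomial (Fin n) ℂ) (h : BiLipschitzRightLeftEquivAtInfinity f g) :
    f.totalDegree = g.totalDegree := by
  obtain ⟨K, K', hK, hK', φ, hφ, ⟨L, hL, hφL⟩, ψ, -, ⟨L', hL', hψL⟩, hfg⟩ := h
  have hψ_le : ∀ a, ‖ψ a‖ ≤ ‖ψ 0‖ + L' * ‖a‖ := fun a => by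
    have h1 := (hψL a 0).2
    rw [sub_zero] at h1
    linarith [norm_le_norm_add_norm_sub' (ψ a) (ψ 0)]
  have hle_ψ : ∀ a, ‖a‖ ≤ L' * ‖ψ 0‖ + L' * ‖ψ a‖ := fun a => by
    have h1 := (hψL a 0).1
    rw [sub_zero, one_div, inv_mul_le_iff₀ hL'] at h1
    nlinarith [norm_sub_le (ψ a) (ψ 0)]
  have hφ_le : ∀ x₀ ∈ Kᶜ, ∀ x ∈ Kᶜ, ‖φ x‖ ≤ (‖φ x₀‖ + L * ‖x₀‖) + L * ‖x‖ :=
    fun x₀ hx₀ x hx => by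
      nlinarith [(hφL x hx x₀ hx₀).2, norm_sub_le x x₀, norm_le_norm_add_norm_sub' (φ x) (φ x₀)]
  have hle_φ : ∀ x₀ ∈ Kᶜ, ∀ x ∈ Kᶜ, ‖x‖ ≤ (‖x₀‖ + L * ‖φ x₀‖) + L * ‖φ x‖ :=
    fun x₀ hx₀ x hx => by
      have h1 := (hφL x hx x₀ hx₀).1
      rw [one_div, inv_mul_le_iff₀ hL] at h1
      nlinarith [norm_sub_le (φ x) (φ x₀), norm_le_norm_add_norm_sub' x x₀]
  have hM : 0 ≤ max L L' := hL.le.trans (le_max_left _ _)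
  have widen : ∀ {s t a b c u : ℝ}, 0 ≤ t → s ≤ a + b * t → a ≤ c → b ≤ u → s ≤ c + u * t :=
    fun ht hs hac hbu => hs.trans (by gcongr)
  rcases Set.eq_empty_or_nonempty Kᶜ with hempty | ⟨x₀, hx₀⟩
  · have hempty' : K'ᶜ = ∅ := by rw [← hφ.image_eq, hempty, Set.image_empty]
    exact le_antisymm
      (totalDegree_le_of_affine_control g f hK 0 0 le_rfl (by simp [hempty]))
      (totalDegree_le_of_affine_control f g hK' 0 0 le_rfl (by simp [hempty']))
  · refine le_antisymm
      (totalDegree_le_of_affine_control g f hK (max (‖φ x₀‖ + L * ‖x₀‖) ‖ψ 0‖) (max L L') hM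
        fun x hx => ⟨φ x, ?_, ?_⟩)
      (totalDegree_le_of_affine_control f g hK' (max (‖x₀‖ + L * ‖φ x₀‖) (L' * ‖ψ 0‖)) (max L L')
        hM fun y hy => ?_)
    · exact widen (norm_nonneg _) (hφ_le x₀ hx₀ x hx) (le_max_left _ _) (le_max_left _ _)
    · rw [hfg x hx]
      exact widen (norm_nonneg _) (hψ_le _) (le_max_right _ _) (le_max_right _ _)
    · obtain ⟨x, hx, rfl⟩ := hφ.surjOn hy
      refine ⟨x, widen (norm_nonneg _) (hle_φ x₀ hx₀ x hx) (le_max_left _ _) (le_max_left _ _), ?_⟩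
      rw [hfg x hx]
      exact widen (norm_nonneg _) (hle_ψ _) (le_max_right _ _) (le_max_right _ _)
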